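/- Let V be a real vector space of dimension 2n with a nondegenerate symmetric bilinear form γ₀ and a real endomorphism F of V such that F² = Id and γ₀(F X, Y) + γ₀(X, F Y) = 0 (a classical almost para-Hermitian structure). Define endomorphisms of V ⊕ V* by 𝓕(X, α) = (F X, -α∘F), 𝓗(X, α) = (♯_{γ₀} α, -γ₀(X,·)) where ♯_{γ₀} is the inverse of X ↦ γ₀(X,·), and 𝓙 = 𝓕∘𝓗. Then 𝓕 is a generalized almost para-complex structure, 𝓙 is a generalized almost complex structure, 𝓕 and 𝓙 commute, and the bilinear form γ(α, β) = -2 g(𝓕(0,α), 𝓙(0,β)) on V* is nondegenerate; hence (𝓕, 𝓙) is a generalized almost para-Hermitian structure on V, and its associated triple is (γ₀, ψ = 0, F) (with F regarded as a complex endomorphism of V^ℂ). -/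

import Mathlib

noncomputable section

open TensorProduct

attribute [local instance 3000] TensorProduct.addCommMonoid TensorProduct.leftModule

/-- The "big tangent space" `V ⊕ V*`. -/
abbrev Big (V : Type) [AddCommGroup V] [Module ℝ V] : Type := V × Module.Dual ℝ V

variable (V : Type) [AddCommGroup V] [Module ℝ V]

/-- The pairing metric `g((X,α),(Y,β)) = (α Y + β X)/2` on `V ⊕ V*`. -/
def gP : Big V →ₗ[ℝ] Big V →ₗ[ℝ] ℝ :=
  LinearMap.mk₂ ℝ (fun u v => (u.2 v.1 + v.2 u.1) / 2)
    (fun m₁ m₂ n => by simp; ring)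
    (fun c m n => by simp; ring)
    (fun m n₁ n₂ => by simp; ring)
    (fun c m n => by simp; ring)

/-- A generalized almost para-complex structure on `V`. -/
def IsGenParaCx (F : Big V →ₗ[ℝ] Big V) : Prop :=
  F ∘ₗ F = LinearMap.id ∧ ∀ u v, gP V (F u) v = - gP V u (F v)

/-- A generalized almost complex structure on `V`. -/
def IsGenCx (J : Big V →ₗ[ℝ] Big V) : Prop :=
  J ∘ₗ J = - LinearMap.id ∧ ∀ u v, gP V (J u) v = - gP V u (J v)

/-- The bilinear form `γ(α,β) = -2 g(𝓕(0,α), 𝓙(0,β))` on `V*`. -/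
def gammaOf (F J : Big V →ₗ[ℝ] Big V) (α β : Module.Dual ℝ V) : ℝ :=
  -2 * gP V (F (0, α)) (J (0, β))

/-- A generalized almost para-Hermitian structure on `V`: a commuting pair of a
generalized almost para-complex structure and a generalized almost complex structure
whose associated bilinear form `γ` on `V*` is nondegenerate. -/
def IsGAPH (F J : Big V →ₗ[ℝ] Big V) : Prop :=
  IsGenParaCx V F ∧ IsGenCx V J ∧ F ∘ₗ J = J ∘ₗ F ∧
    ∀ α, (∀ β, gammaOf V F J α β = 0) → α = 0

/-- Complexification of `V`. -/
abbrev Vc : Type := ℂ ⊗[ℝ] V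

/-- Complexification of the big space `V ⊕ V*`. -/
abbrev Bc : Type := ℂ ⊗[ℝ] Big V

/-- The projection `(V ⊕ V*)^ℂ → V^ℂ`. -/
def prV : Bc V →ₗ[ℂ] Vc V := LinearMap.baseChange ℂ (LinearMap.fst ℝ V (Module.Dual ℝ V))

/-- The inclusion `V^ℂ → (V ⊕ V*)^ℂ`, `X ↦ (X, 0)`. -/
def inV : Vc V →ₗ[ℂ] Bc V := LinearMap.baseChange ℂ (LinearMap.inl ℝ V (Module.Dual ℝ V))

/-- The complexified pairing metric on `(V ⊕ V*)^ℂ`. -/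
def gc : Bc V →ₗ[ℂ] Bc V →ₗ[ℂ] ℂ := LinearMap.BilinForm.baseChange ℂ (gP V)

/-- Complex-bilinear extension of a bilinear form on `V` to `V^ℂ`. -/
def bcB (B : LinearMap.BilinForm ℝ V) : Vc V →ₗ[ℂ] Vc V →ₗ[ℂ] ℂ :=
  LinearMap.BilinForm.baseChange ℂ B

/-- The `μ`-eigenspace of an endomorphism of `(V ⊕ V*)^ℂ`. -/
def eigSp (T : Bc V →ₗ[ℂ] Bc V) (μ : ℂ) : Submodule ℂ (Bc V) where
  carrier := {u | T u = μ • u}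
  add_mem' := by
    intro a b ha hb
    simp only [Set.mem_setOf_eq, map_add] at *
    rw [ha, hb, smul_add]
  zero_mem' := by simp
  smul_mem' := by
    intro c u hu
    simp only [Set.mem_setOf_eq, map_smul] at *
    rw [hu, smul_comm]

/-- The `i`-eigenspace of the complexification of an endomorphism of `V ⊕ V*`. -/
def Hsp (H : Big V →ₗ[ℝ] Big V) : Submodule ℂ (Bc V) :=
  eigSp V (LinearMap.baseChange ℂ H) Complex.I

/-- The `+1`-eigenspace of the complexification of an endomorphism of `V ⊕ V*`. -/
def Fplus (F : Big V →ₗ[ℝ] Big V) : Submodule ℂ (Bc V) :=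
  eigSp V (LinearMap.baseChange ℂ F) 1

/-- The `-1`-eigenspace of the complexification of an endomorphism of `V ⊕ V*`. -/
def Fminus (F : Big V →ₗ[ℝ] Big V) : Submodule ℂ (Bc V) :=
  eigSp V (LinearMap.baseChange ℂ F) (-1)

/-- The graph `{(X, ψ^ℂ(X,·) + i γ₀^ℂ(X,·)) : X ∈ V^ℂ}` inside `(V ⊕ V*)^ℂ`.
An element `u = (X, α)` lies on the graph iff `α(Y) = ψ^ℂ(X,Y) + i γ₀^ℂ(X,Y)` for all
`Y ∈ V^ℂ`; the value `α(Y)` is expressed canonically as `2 g^ℂ(u, (Y,0))`. -/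
def graphSet (γ₀ ψ : LinearMap.BilinForm ℝ V) : Set (Bc V) :=
  {u | ∀ Y : Vc V, 2 * gc V u (inV V Y) =
      bcB V ψ (prV V u) Y + Complex.I * bcB V γ₀ (prV V u) Y}

/-- Complex conjugation of `(V ⊕ V*)^ℂ` with respect to the real form `V ⊕ V*`. -/
def conjMap : Bc V →ₗ[ℝ] Bc V := LinearMap.rTensor (Big V) Complex.conjAe.toLinearMap

/-- The complex conjugate of a complex subspace of `(V ⊕ V*)^ℂ` (the image of the
subspace under conjugation; taking the `ℂ`-span does not enlarge the image, since the
image of a complex subspace under conjugation is again a complex subspace). -/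
def conjSub (S : Submodule ℂ (Bc V)) : Submodule ℂ (Bc V) :=
  Submodule.span ℂ (conjMap V '' (S : Set (Bc V)))

noncomputable instance (S : Submodule ℂ (Bc V)) : AddCommGroup ↥S :=
  Module.addCommMonoidToAddCommGroup ℂ

/-- A `g`-isotropic subspace of `(V ⊕ V*)^ℂ`. -/
def IsIsotropic (S : Submodule ℂ (Bc V)) : Prop := ∀ u ∈ S, ∀ v ∈ S, gc V u v = 0

/-- A maximal `g`-isotropic subspace of `(V ⊕ V*)^ℂ`: a `g`-isotropic subspace of
complex dimension `dim V`. -/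
def MaxIsotropic (S : Submodule ℂ (Bc V)) : Prop :=
  IsIsotropic V S ∧ Module.finrank ℂ S = Module.finrank ℝ V

/-- The endomorphism of `V^ℂ` induced by an endomorphism `A` of `V ⊕ V*` via `τ`:
`X ↦ pr_{V^ℂ} (A^ℂ (τ X))`. -/
def Fop (A : Big V →ₗ[ℝ] Big V) (τ : Vc V →ₗ[ℂ] Bc V) : Vc V → Vc V :=
  fun X => prV V (LinearMap.baseChange ℂ A (τ X))

/-- The canonical (real) inclusion `V → V^ℂ`. -/
def realIncl : V →ₗ[ℝ] Vc V := TensorProduct.mk ℝ ℂ V 1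

/-- The canonical (real) inclusion `V ⊕ V* → (V ⊕ V*)^ℂ`. -/
def realInclB : Big V →ₗ[ℝ] Bc V := TensorProduct.mk ℝ ℂ (Big V) 1

/-- The B-field transformation `(X, α) ↦ (X, α + B(X,·))` of `V ⊕ V*`. -/
def Bfield (B : LinearMap.BilinForm ℝ V) : Big V →ₗ[ℝ] Big V :=
  LinearMap.prod (LinearMap.fst ℝ V (Module.Dual ℝ V))
    (LinearMap.snd ℝ V (Module.Dual ℝ V) + B ∘ₗ LinearMap.fst ℝ V (Module.Dual ℝ V))

/-- `(X, α) ↦ (F X, -α ∘ F)`. -/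
def genF (F : V →ₗ[ℝ] V) : Big V →ₗ[ℝ] Big V := F.prodMap (- F.dualMap)

/-- `(X, α) ↦ (♯ α, -γ₀(X,·))`. -/
def genH (γ₀ : LinearMap.BilinForm ℝ V) (sharp : Module.Dual ℝ V →ₗ[ℝ] V) :
    Big V →ₗ[ℝ] Big V :=
  LinearMap.prod (sharp ∘ₗ LinearMap.snd ℝ V (Module.Dual ℝ V))
    (- (γ₀ ∘ₗ LinearMap.fst ℝ V (Module.Dual ℝ V)))

/-- The projection `(1/4)(Id + 𝓕^ℂ) ∘ (Id - i 𝓗^ℂ)` onto `𝐇₊`, as a function. -/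
def prHplus (F H : Big V →ₗ[ℝ] Big V) (u : Bc V) : Bc V :=
  ((1 : ℂ)/4) • ((u - Complex.I • LinearMap.baseChange ℂ H u) +
    LinearMap.baseChange ℂ F (u - Complex.I • LinearMap.baseChange ℂ H u))

/-- The projection `(1/4)(Id - 𝓕^ℂ) ∘ (Id - i 𝓗^ℂ)` onto `𝐇₋`, as a function. -/
def prHminus (F H : Big V →ₗ[ℝ] Big V) (u : Bc V) : Bc V :=
  ((1 : ℂ)/4) • ((u - Complex.I • LinearMap.baseChange ℂ H u) -
    LinearMap.baseChange ℂ F (u - Complex.I • LinearMap.baseChange ℂ H u))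

/-- The inclusion `W ⊕ V* → V ⊕ V*` over a subspace `W ⊆ V`. -/
def bigIncl (W : Submodule ℝ V) : (↥W × Module.Dual ℝ V) →ₗ[ℝ] Big V :=
  (W.subtype).prodMap LinearMap.id

/-- The restriction `W ⊕ V* → W ⊕ W*`, restricting functionals to `W`. -/
def bigRes (W : Submodule ℝ V) : (↥W × Module.Dual ℝ V) →ₗ[ℝ] Big ↥W :=
  LinearMap.prodMap LinearMap.id (W.subtype.dualMap)

/-- The pullback `ι*U = {(X, η∘ι) : X ∈ W^ℂ, (X, η) ∈ U}` of a subspace of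
`(V ⊕ V*)^ℂ` to `(W ⊕ W*)^ℂ`. -/
def pullback (W : Submodule ℝ V) (U : Submodule ℂ (Bc V)) : Submodule ℂ (Bc ↥W) :=
  Submodule.map (LinearMap.baseChange ℂ (bigRes V W))
    (Submodule.comap (LinearMap.baseChange ℂ (bigIncl V W)) U)

/-- Restriction of a bilinear form on `V` to a subspace `W`. -/
def resB (W : Submodule ℝ V) (B : LinearMap.BilinForm ℝ V) : LinearMap.BilinForm ℝ ↥W :=
  B.compl₁₂ W.subtype W.subtype

lemma exists_one_tmul_add_I_tmul {M : Type} [AddCommGroup M] [Module ℝ M] (u : ℂ ⊗[ℝ] M) :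
    ∃ a b : M, u = (1 : ℂ) ⊗ₜ[ℝ] a + Complex.I ⊗ₜ[ℝ] b := by
  induction u using TensorProduct.induction_on with
  | zero => exact ⟨0, 0, by simp⟩
  | tmul z m =>
    refine ⟨z.re • m, z.im • m, ?_⟩
    rw [← TensorProduct.smul_tmul, ← TensorProduct.smul_tmul, ← TensorProduct.add_tmul]
    congr 1
    apply Complex.ext <;> simp
  | add x y hx hy =>
    obtain ⟨a, b, rfl⟩ := hx
    obtain ⟨c, d, rfl⟩ := hy
    refine ⟨a + c, b + d, ?_⟩
    rw [TensorProduct.tmul_add, TensorProduct.tmul_add]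
    abel

section

variable {V}

lemma gP_apply (u v : Big V) : gP V u v = (u.2 v.1 + v.2 u.1) / 2 := rfl

lemma genF_apply (F : V →ₗ[ℝ] V) (u : Big V) : genF V F u = (F u.1, -(u.2 ∘ₗ F)) := rfl

lemma genH_apply (γ₀ : LinearMap.BilinForm ℝ V) (sharp : Module.Dual ℝ V →ₗ[ℝ] V)
    (u : Big V) : genH V γ₀ sharp u = (sharp u.2, -γ₀ u.1) := rfl

lemma gc_tmul (z w : ℂ) (u v : Big V) :
    gc V (z ⊗ₜ[ℝ] u) (w ⊗ₜ[ℝ] v) = (w * z) * (gP V u v : ℂ) := by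
  simp [gc, LinearMap.BilinForm.baseChange_tmul, mul_comm]

lemma bcB_tmul (B : LinearMap.BilinForm ℝ V) (z w : ℂ) (x y : V) :
    bcB V B (z ⊗ₜ[ℝ] x) (w ⊗ₜ[ℝ] y) = (w * z) * (B x y : ℂ) := by
  simp [bcB, LinearMap.BilinForm.baseChange_tmul, mul_comm]

lemma bcB_zero (X Y : Vc V) : bcB V (0 : LinearMap.BilinForm ℝ V) X Y = 0 := by
  induction X using TensorProduct.induction_on with
  | zero => simp
  | add x y hx hy => rw [map_add, LinearMap.add_apply, hx, hy, add_zero]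
  | tmul z m =>
    induction Y using TensorProduct.induction_on with
    | zero => simp
    | add x y hx hy => rw [map_add, hx, hy, add_zero]
    | tmul w k => simp [bcB_tmul]

lemma prV_tmul (z : ℂ) (u : Big V) : prV V (z ⊗ₜ[ℝ] u) = z ⊗ₜ[ℝ] u.1 := rfl

lemma inV_tmul (z : ℂ) (x : V) : inV V (z ⊗ₜ[ℝ] x) = z ⊗ₜ[ℝ] ((x, 0) : Big V) := rfl

lemma two_mul_gc_genH (γ₀ : LinearMap.BilinForm ℝ V) (sharp : Module.Dual ℝ V →ₗ[ℝ] V)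
    (u : Bc V) (Y : Vc V) :
    2 * gc V (LinearMap.baseChange ℂ (genH V γ₀ sharp) u) (inV V Y) =
      -bcB V γ₀ (prV V u) Y := by
  induction u using TensorProduct.induction_on with
  | zero => simp
  | add x y hx hy =>
    simp only [map_add, LinearMap.add_apply, mul_add, hx, hy, neg_add]
  | tmul z a =>
    induction Y using TensorProduct.induction_on with
    | zero => simp
    | add x y hx hy => simp only [map_add, mul_add, hx, hy, neg_add]
    | tmul w y =>
      rw [LinearMap.baseChange_tmul, inV_tmul, gc_tmul, prV_tmul, bcB_tmul, gP_apply, genH_apply]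
      simp
      ring

lemma prV_baseChange_genF (F : V →ₗ[ℝ] V) (u : Bc V) :
    prV V (LinearMap.baseChange ℂ (genF V F) u) = LinearMap.baseChange ℂ F (prV V u) := by
  induction u using TensorProduct.induction_on with
  | zero => simp
  | add x y hx hy => simp only [map_add, hx, hy]
  | tmul z a => rfl

lemma Hsp_genH_eq_graphSet (γ₀ : LinearMap.BilinForm ℝ V) (sharp : Module.Dual ℝ V →ₗ[ℝ] V)
    (hsharp : ∀ X, sharp (γ₀ X) = X) :
    (Hsp V (genH V γ₀ sharp) : Set (Bc V)) = graphSet V γ₀ 0 := by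
  ext u
  constructor
  · intro hu Y
    have hu' : LinearMap.baseChange ℂ (genH V γ₀ sharp) u = Complex.I • u := hu
    have h := two_mul_gc_genH γ₀ sharp u Y
    rw [hu', map_smul, LinearMap.smul_apply, smul_eq_mul] at h
    rw [bcB_zero, zero_add]
    linear_combination (-Complex.I) * h + (2 * gc V u (inV V Y)) * Complex.I_mul_I
  · intro hu
    obtain ⟨a, b, rfl⟩ := exists_one_tmul_add_I_tmul u
    have key : ∀ y, a.2 y = -γ₀ b.1 y ∧ b.2 y = γ₀ a.1 y := by
      intro y
      have h := hu ((1 : ℂ) ⊗ₜ[ℝ] y)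
      rw [bcB_zero, zero_add, inV_tmul] at h
      simp only [map_add, LinearMap.add_apply, gc_tmul, prV_tmul, bcB_tmul, gP_apply] at h
      have hre := congrArg Complex.re h
      have him := congrArg Complex.im h
      simp at hre him
      constructor <;> linarith
    have ha : a.2 = -γ₀ b.1 := LinearMap.ext fun y => (key y).1
    have hb : b.2 = γ₀ a.1 := LinearMap.ext fun y => (key y).2
    have hHa : genH V γ₀ sharp a = -b := by
      rw [genH_apply, ha, ← hb, map_neg, hsharp]; rfl
    have hHb : genH V γ₀ sharp b = a := by
      rw [genH_apply, hb, ← ha, hsharp]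
    change LinearMap.baseChange ℂ (genH V γ₀ sharp) _ = Complex.I • _
    rw [map_add, LinearMap.baseChange_tmul, LinearMap.baseChange_tmul, hHa, hHb, smul_add,
      TensorProduct.smul_tmul', TensorProduct.smul_tmul', smul_eq_mul, smul_eq_mul,
      Complex.I_mul_I, mul_one, TensorProduct.tmul_neg, TensorProduct.neg_tmul, add_comm]

end

/-- A classical almost para-Hermitian structure `(γ₀, F)` on `V`
(`F² = Id`, `γ₀(FX,Y) + γ₀(X,FY) = 0`, `dim V = 2n`) gives rise to a generalized almost
para-Hermitian structure `(𝓕, 𝓙)` with `𝓕(X,α) = (FX, -α∘F)`,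
`𝓗(X,α) = (♯_{γ₀}α, -γ₀(X,·))`, `𝓙 = 𝓕∘𝓗`, whose associated triple is `(γ₀, 0, F^ℂ)`. -/
theorem classical_para_hermitian (V : Type) [AddCommGroup V] [Module ℝ V]
    [FiniteDimensional ℝ V] (n : ℕ) (hdim : Module.finrank ℝ V = 2 * n)
    (γ₀ : LinearMap.BilinForm ℝ V)
    (hsym : ∀ x y, γ₀ x y = γ₀ y x) (hnd : ∀ x, (∀ y, γ₀ x y = 0) → x = 0)
    (F : V →ₗ[ℝ] V) (hF2 : F ∘ₗ F = LinearMap.id)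
    (hFsk : ∀ X Y, γ₀ (F X) Y + γ₀ X (F Y) = 0)
    (sharp : Module.Dual ℝ V →ₗ[ℝ] V)
    (hsharp₁ : ∀ X, sharp (γ₀ X) = X) (hsharp₂ : ∀ α, γ₀ (sharp α) = α) :
    IsGenParaCx V (genF V F) ∧
    IsGenCx V (genF V F ∘ₗ genH V γ₀ sharp) ∧
    (genF V F ∘ₗ (genF V F ∘ₗ genH V γ₀ sharp) = (genF V F ∘ₗ genH V γ₀ sharp) ∘ₗ genF V F) ∧
    (∀ α, (∀ β, gammaOf V (genF V F) (genF V F ∘ₗ genH V γ₀ sharp) α β = 0) → α = 0) ∧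
    ((Hsp V ((genF V F ∘ₗ genH V γ₀ sharp) ∘ₗ genF V F) : Set (Bc V)) = graphSet V γ₀ 0) ∧
    (∀ u ∈ Hsp V ((genF V F ∘ₗ genH V γ₀ sharp) ∘ₗ genF V F),
      prV V (LinearMap.baseChange ℂ (genF V F) u) = LinearMap.baseChange ℂ F (prV V u)) := by
  have hFF : ∀ x, F (F x) = x := LinearMap.congr_fun hF2
  have hγF : ∀ x, γ₀ (F x) = -(γ₀ x ∘ₗ F) := fun x =>
    LinearMap.ext fun y => eq_neg_of_add_eq_zero_left (hFsk x y)
  have hFsharp : ∀ α : Module.Dual ℝ V, F (sharp α) = -sharp (α ∘ₗ F) := fun α => by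
    rw [← hsharp₁ (F (sharp α)), hγF, hsharp₂, map_neg]
  have hFF' : genF V F ∘ₗ genF V F = LinearMap.id := by
    refine LinearMap.ext fun u => Prod.ext (hFF u.1) (LinearMap.ext fun y => ?_)
    simp [genF_apply, hFF]
  have hFH : genF V F ∘ₗ genH V γ₀ sharp = genH V γ₀ sharp ∘ₗ genF V F := by
    refine LinearMap.ext fun u => Prod.ext ?_ (LinearMap.ext fun y => ?_)
    · simp [genF_apply, genH_apply, hFsharp]
    · simp [genF_apply, genH_apply, hγF]
  have hHH : genH V γ₀ sharp ∘ₗ genH V γ₀ sharp = -LinearMap.id := by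
    refine LinearMap.ext fun u => Prod.ext ?_ ?_
    · simp [genH_apply, hsharp₁]
    · simp [genH_apply, hsharp₂]
  have hFskew : ∀ u v, gP V (genF V F u) v = -gP V u (genF V F v) := fun u v => by
    simp [gP_apply, genF_apply]; ring
  have hHsymm : ∀ u v, gP V (genH V γ₀ sharp u) v = gP V u (genH V γ₀ sharp v) := fun u v => by
    have h : ∀ α β : Module.Dual ℝ V, α (sharp β) = β (sharp α) := fun α β => by
      conv_lhs => rw [← hsharp₂ α, hsym, hsharp₂]
    simp only [gP_apply, genH_apply, LinearMap.neg_apply, hsym u.1 v.1, h v.2 u.2]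
    ring
  have hJF : (genF V F ∘ₗ genH V γ₀ sharp) ∘ₗ genF V F = genH V γ₀ sharp := by
    rw [hFH, LinearMap.comp_assoc, hFF', LinearMap.comp_id]
  refine ⟨⟨hFF', hFskew⟩, ⟨?_, ?_⟩, ?_, ?_, ?_, ?_⟩
  · rw [← LinearMap.comp_assoc, hJF, hHH]
  · intro u v
    rw [LinearMap.comp_apply, hFskew, hHsymm, hFH, LinearMap.comp_apply]
  · rw [hJF, ← LinearMap.comp_assoc, hFF', LinearMap.id_comp]
  · intro α hα
    refine LinearMap.ext fun x => ?_
    have h := hα (γ₀ x)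
    rw [gammaOf, hFskew, LinearMap.comp_apply, ← LinearMap.comp_apply (genF V F), hFF'] at h
    simpa [gP_apply, genH_apply, hsharp₁] using h
  · rw [hJF]
    exact Hsp_genH_eq_graphSet γ₀ sharp hsharp₁
  · exact fun u _ => prV_baseChange_genF F u
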